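/- arXiv:math/0302192 — 5 statements merged into one kernel-verified Lean document; each statement's English description precedes it below -/
import Mathlib

section
/- Let (Z,A,S) be a normal regular bivariate Birkhoff interpolation scheme and set n = |Z|. Then for every lower set L ⊆ S one has n·|L ∩ A| ≥ |L|. Moreover, if equality n·|L ∩ A| = |L| holds for some lower set L ⊆ S, then the scheme (Z, A ∩ L, L) is also regular. -/
open Finset

/-- A finite subset of `ℤ≥0²` is a *lower set* if it is closed under
coordinatewise decrease. -/
def IsLower (S : Finset (ℕ × ℕ)) : Prop :=
  ∀ u v, (u, v) ∈ S → ∀ i j, i ≤ u → j ≤ v → (i, j) ∈ S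

/-- The value at `(x,y)` of `∂^{i+j}P/∂x^i∂y^j`, where `P` is the polynomial
with coefficients `a` supported on `S`. -/
noncomputable def derivAt (S : Finset (ℕ × ℕ)) (a : ℕ × ℕ → ℝ) (i j : ℕ) (x y : ℝ) : ℝ :=
  ∑ uv ∈ S, a uv * (uv.1.descFactorial i : ℝ) * (uv.2.descFactorial j : ℝ) *
      x ^ (uv.1 - i) * y ^ (uv.2 - j)

/-- The bivariate Birkhoff scheme `(Z,A,S)` is *regular*: every interpolation
problem has a unique solution in `P_S` (polynomials supported on `S`). -/
def Regular (Z : Finset (ℝ × ℝ)) (A S : Finset (ℕ × ℕ)) : Prop :=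
  ∀ c : ℕ × ℕ → ℝ × ℝ → ℝ, ∃! a : ℕ × ℕ → ℝ,
    (∀ uv, uv ∉ S → a uv = 0) ∧
    ∀ z ∈ Z, ∀ ij ∈ A, derivAt S a ij.1 ij.2 z.1 z.2 = c ij z

/-- The scheme `(Z,A,S)` is *solvable*: every interpolation problem has at
least one solution in `P_S`. -/
def Solvable (Z : Finset (ℝ × ℝ)) (A S : Finset (ℕ × ℕ)) : Prop :=
  ∀ c : ℕ × ℕ → ℝ × ℝ → ℝ, ∃ a : ℕ × ℕ → ℝ,
    (∀ uv, uv ∉ S → a uv = 0) ∧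
    ∀ z ∈ Z, ∀ ij ∈ A, derivAt S a ij.1 ij.2 z.1 z.2 = c ij z

/-- `Z ⊂ ℝ²` is a `(p,q)`-rectangular set of nodes. -/
def IsRect (p q : ℕ) (Z : Finset (ℝ × ℝ)) : Prop :=
  ∃ x : Fin (p + 1) → ℝ, ∃ y : Fin (q + 1) → ℝ,
    Function.Injective x ∧ Function.Injective y ∧
    Z = (Finset.univ : Finset (Fin (p + 1) × Fin (q + 1))).image (fun ij => (x ij.1, y ij.2))

/-- `B_x = {i : (i,0) ∈ B}`. -/
def setX (B : Finset (ℕ × ℕ)) : Finset ℕ := (B.filter fun ij => ij.2 = 0).image Prod.fst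

/-- `B_y = {j : (0,j) ∈ B}`. -/
def setY (B : Finset (ℕ × ℕ)) : Finset ℕ := (B.filter fun ij => ij.1 = 0).image Prod.snd

/-- `B_x[β] = {α : (α,β) ∈ B}`. -/
def sliceX (B : Finset (ℕ × ℕ)) (b : ℕ) : Finset ℕ := (B.filter fun ij => ij.2 = b).image Prod.fst

/-- `B_y[α] = {β : (α,β) ∈ B}`. -/
def sliceY (B : Finset (ℕ × ℕ)) (a : ℕ) : Finset ℕ := (B.filter fun ij => ij.1 = a).image Prod.snd

/-- Projection of the nodes on the OX axis. -/
noncomputable def nodesX (Z : Finset (ℝ × ℝ)) : Finset ℝ := Z.image Prod.fst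

/-- Projection of the nodes on the OY axis. -/
noncomputable def nodesY (Z : Finset (ℝ × ℝ)) : Finset ℝ := Z.image Prod.snd

/-- The rectangle `R(u,v) = {(i,j) : i ≤ u, j ≤ v}`. -/
def rect (u v : ℕ) : Finset (ℕ × ℕ) := Finset.range (u + 1) ×ˢ Finset.range (v + 1)

/-- The blow-up `R^{p,q} = {(α,β) : (⌊α/(p+1)⌋, ⌊β/(q+1)⌋) ∈ R}`. -/
def blowup (p q : ℕ) (R : Finset (ℕ × ℕ)) : Finset (ℕ × ℕ) :=
  (R ×ˢ (Finset.range (p + 1) ×ˢ Finset.range (q + 1))).image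
    (fun x => ((p + 1) * x.1.1 + x.2.1, (q + 1) * x.1.2 + x.2.2))

/-- `n_{p,q}(L)`: number of `(α,β) ∈ L` with `(p+1) ∣ α` and `(q+1) ∣ β`. -/
def npq (p q : ℕ) (L : Finset (ℕ × ℕ)) : ℕ :=
  (L.filter fun ab => (p + 1) ∣ ab.1 ∧ (q + 1) ∣ ab.2).card

/-- Value at `x` of the `i`-th derivative of the univariate polynomial with
coefficients `a` supported on `S`. -/
noncomputable def derivAt1 (S : Finset ℕ) (a : ℕ → ℝ) (i : ℕ) (x : ℝ) : ℝ :=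
  ∑ u ∈ S, a u * (u.descFactorial i : ℝ) * x ^ (u - i)

/-- Regularity of the univariate Birkhoff scheme `(W,A,S)`. -/
def Regular1 (W : Finset ℝ) (A S : Finset ℕ) : Prop :=
  ∀ c : ℕ → ℝ → ℝ, ∃! a : ℕ → ℝ,
    (∀ u, u ∉ S → a u = 0) ∧
    ∀ w ∈ W, ∀ i ∈ A, derivAt1 S a i w = c i w

/-- `(A,S)` is almost regular with respect to `(p,q)`-rectangular sets of nodes. -/
def AlmostRegular (p q : ℕ) (A S : Finset (ℕ × ℕ)) : Prop :=
  ∃ Z : Finset (ℝ × ℝ), IsRect p q Z ∧ Regular Z A S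


/-- Extension by zero of a family of coefficients indexed by `L`, as a linear map. -/
noncomputable def extendCoeff (L : Finset (ℕ × ℕ)) : (L → ℝ) →ₗ[ℝ] (ℕ × ℕ → ℝ) where
  toFun a uv := if h : uv ∈ L then a ⟨uv, h⟩ else 0
  map_add' a b := by
    funext uv
    by_cases h : uv ∈ L <;> simp [h]
  map_smul' r a := by
    funext uv
    by_cases h : uv ∈ L <;> simp [h]

lemma extendCoeff_of_notMem {L : Finset (ℕ × ℕ)} (a : L → ℝ) {uv : ℕ × ℕ} (h : uv ∉ L) :
    extendCoeff L a uv = 0 := by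
  simp [extendCoeff, h]

lemma extendCoeff_coe {L : Finset (ℕ × ℕ)} (a : L → ℝ) (uv : L) :
    extendCoeff L a uv = a uv := by
  simp [extendCoeff]

lemma extendCoeff_restrict {L : Finset (ℕ × ℕ)} {a : ℕ × ℕ → ℝ} (ha : ∀ uv, uv ∉ L → a uv = 0) :
    extendCoeff L (fun uv => a uv) = a := by
  funext uv
  by_cases h : uv ∈ L
  · simp [extendCoeff, h]
  · rw [extendCoeff_of_notMem _ h, ha uv h]

/-- The derivative value `derivAt` as a linear functional of the coefficients. -/
noncomputable def derivAtLinear (S : Finset (ℕ × ℕ)) (i j : ℕ) (x y : ℝ) :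
    (ℕ × ℕ → ℝ) →ₗ[ℝ] ℝ where
  toFun a := derivAt S a i j x y
  map_add' a b := by
    simp only [derivAt, Pi.add_apply, add_mul, Finset.sum_add_distrib]
  map_smul' r a := by
    simp only [derivAt, Pi.smul_apply, smul_eq_mul, RingHom.id_apply, Finset.mul_sum, mul_assoc]

/-- A derivative whose order lies outside the lower set `L` kills polynomials supported on `L`. -/
lemma derivAt_eq_zero_of_notMem {L : Finset (ℕ × ℕ)} (hL : IsLower L) (a : ℕ × ℕ → ℝ)
    {i j : ℕ} (h : (i, j) ∉ L) (x y : ℝ) : derivAt L a i j x y = 0 := by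
  refine Finset.sum_eq_zero fun uv huv => ?_
  by_cases hi : i ≤ uv.1
  · have hj : uv.2 < j := by
      by_contra! hj
      exact h (hL uv.1 uv.2 huv i j hi hj)
    simp [Nat.descFactorial_of_lt hj]
  · simp [Nat.descFactorial_of_lt (not_le.mp hi)]

lemma derivAt_eq_of_subset {L S : Finset (ℕ × ℕ)} (hLS : L ⊆ S) {a : ℕ × ℕ → ℝ}
    (ha : ∀ uv, uv ∉ L → a uv = 0) (i j : ℕ) (x y : ℝ) :
    derivAt S a i j x y = derivAt L a i j x y := by
  refine (Finset.sum_subset hLS fun uv _ huv => ?_).symm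
  simp [ha uv huv]

/-- The evaluation map of the scheme `(Z, A, L)` on the coefficients indexed by `L`. -/
noncomputable def evalMap (Z : Finset (ℝ × ℝ)) (A L : Finset (ℕ × ℕ)) :
    (L → ℝ) →ₗ[ℝ] (Z × A → ℝ) :=
  LinearMap.pi fun p =>
    derivAtLinear L p.2.1.1 p.2.1.2 p.1.1.1 p.1.1.2 ∘ₗ extendCoeff L

lemma evalMap_apply (Z : Finset (ℝ × ℝ)) (A L : Finset (ℕ × ℕ)) (a : L → ℝ) (p : Z × A) :
    evalMap Z A L a p =
      derivAt L (extendCoeff L a) p.2.1.1 p.2.1.2 p.1.1.1 p.1.1.2 :=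
  rfl

/-- A scheme is regular as soon as its evaluation map is bijective. -/
lemma regular_of_bijective_evalMap {Z : Finset (ℝ × ℝ)} {A L : Finset (ℕ × ℕ)}
    (h : Function.Bijective (evalMap Z A L)) : Regular Z A L := by
  intro c
  obtain ⟨a, ha⟩ := h.2 fun p => c p.2.1 p.1.1
  refine ⟨extendCoeff L a, ⟨fun uv huv => extendCoeff_of_notMem a huv, ?_⟩, ?_⟩
  · intro z hz ij hij
    exact congrFun ha (⟨z, hz⟩, ⟨ij, hij⟩)
  · rintro b ⟨hb, hbc⟩
    rw [← extendCoeff_restrict hb]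
    congr 1
    apply h.1
    rw [ha]
    funext p
    rw [evalMap_apply, extendCoeff_restrict hb]
    exact hbc _ p.1.2 _ p.2.2

/-- Restricting a regular scheme to a lower subset `L` of its support yields an injective
evaluation map, even if only the derivative orders in `L` are kept. -/
lemma Regular.injective_evalMap {Z : Finset (ℝ × ℝ)} {A S L : Finset (ℕ × ℕ)}
    (hreg : Regular Z A S) (hLS : L ⊆ S) (hL : IsLower L) :
    Function.Injective (evalMap Z (A ∩ L) L) := by
  refine (injective_iff_map_eq_zero _).2 fun a ha => ?_
  have hsupp : ∀ uv, uv ∉ L → extendCoeff L a uv = 0 := fun uv huv =>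
    extendCoeff_of_notMem a huv
  have hzero : extendCoeff L a = 0 := by
    refine (hreg fun _ _ => 0).unique ⟨fun uv huv => hsupp uv fun h => huv (hLS h), ?_⟩
      ⟨fun _ _ => rfl, fun z _ ij _ => by simp [derivAt]⟩
    intro z hz ij hij
    rw [derivAt_eq_of_subset hLS hsupp]
    by_cases h : ij ∈ L
    · exact congrFun ha (⟨z, hz⟩, ⟨ij, Finset.mem_inter.2 ⟨hij, h⟩⟩)
    · exact derivAt_eq_zero_of_notMem hL _ h _ _
  funext uv
  rw [← extendCoeff_coe a uv, hzero]
  rfl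

/-- Polya condition for normal regular bivariate Birkhoff schemes,
with the limit case. -/
theorem polya_condition (Z : Finset (ℝ × ℝ)) (A S : Finset (ℕ × ℕ))
    (hS : IsLower S) (hnorm : S.card = Z.card * A.card) (hreg : Regular Z A S) :
    ∀ L ⊆ S, IsLower L →
      L.card ≤ Z.card * (L ∩ A).card ∧
      (Z.card * (L ∩ A).card = L.card → Regular Z (A ∩ L) L) := by
  intro L hLS hL
  have hinj := hreg.injective_evalMap hLS hL
  have hle := LinearMap.finrank_le_finrank_of_injective hinj
  simp only [Module.finrank_fintype_fun_eq_card, Fintype.card_prod, Fintype.card_coe] at hle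
  rw [Finset.inter_comm L A]
  refine ⟨hle, fun heq => regular_of_bijective_evalMap ⟨hinj, ?_⟩⟩
  refine (LinearMap.injective_iff_surjective_of_finrank_eq_finrank ?_).1 hinj
  simp only [Module.finrank_fintype_fun_eq_card, Fintype.card_prod, Fintype.card_coe]
  exact heq.symm
end

section
/- Let (Z,A,S) be a normal regular bivariate Birkhoff interpolation scheme in which Z is (p,q)-rectangular. Then |A| ≤ |A_x|·|A_y|. -/
open Finset

theorem mem_setX {B : Finset (ℕ × ℕ)} {i : ℕ} : i ∈ setX B ↔ (i, 0) ∈ B := by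
  simp [setX]

theorem mem_setY {B : Finset (ℕ × ℕ)} {j : ℕ} : j ∈ setY B ↔ (0, j) ∈ B := by
  simp [setY]

/-- If the interpolation conditions on polynomials supported on `T ⊆ S` reduce to those
indexed by `ι`, then regularity forces `|T| ≤ |ι|`. -/
theorem Regular.card_le_of_forall_derivAt_eq_zero {Z : Finset (ℝ × ℝ)} {A S T : Finset (ℕ × ℕ)}
    (hreg : Regular Z A S) (hT : T ⊆ S) {ι : Type*} [Fintype ι] (d : ι → ℕ × ℕ) (w : ι → ℝ × ℝ)
    (h : ∀ a : ℕ × ℕ → ℝ, (∀ uv, uv ∉ T → a uv = 0) →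
      (∀ k, derivAt S a (d k).1 (d k).2 (w k).1 (w k).2 = 0) →
      ∀ z ∈ Z, ∀ ij ∈ A, derivAt S a ij.1 ij.2 z.1 z.2 = 0) :
    T.card ≤ Fintype.card ι := by
  let e : (T → ℝ) → ℕ × ℕ → ℝ := fun b uv => if huv : uv ∈ T then b ⟨uv, huv⟩ else 0
  have e_add (b c : T → ℝ) (uv) : e (b + c) uv = e b uv + e c uv := by
    by_cases huv : uv ∈ T <;> simp [e, huv]
  have e_smul (r : ℝ) (b : T → ℝ) (uv) : e (r • b) uv = r * e b uv := by
    by_cases huv : uv ∈ T <;> simp [e, huv]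
  have e_supp (b : T → ℝ) (uv) (huv : uv ∉ T) : e b uv = 0 := by simp [e, huv]
  let L : (T → ℝ) →ₗ[ℝ] (ι → ℝ) :=
    { toFun := fun b k => derivAt S (e b) (d k).1 (d k).2 (w k).1 (w k).2
      map_add' := fun b c => by
        ext k
        simp only [derivAt, e_add, Pi.add_apply, add_mul, Finset.sum_add_distrib]
      map_smul' := fun r b => by
        ext k
        simp only [derivAt, e_smul, Pi.smul_apply, smul_eq_mul, RingHom.id_apply,
          Finset.mul_sum, mul_assoc] }
  have hL : Function.Injective L := by
    rw [injective_iff_map_eq_zero]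
    intro b hb
    have hzero := h (e b) (e_supp b) (congrFun hb)
    have hb0 : e b = 0 := (hreg fun _ _ => 0).unique
      ⟨fun uv huv => e_supp b uv fun hmem => huv (hT hmem), hzero⟩
      ⟨fun _ _ => rfl, fun _ _ _ _ => by simp [derivAt]⟩
    ext t
    simpa [e] using congrFun hb0 t.1
  simpa using LinearMap.finrank_le_finrank_of_injective hL

theorem derivAt_eq_zero_of_support_snd {S : Finset (ℕ × ℕ)} {a : ℕ × ℕ → ℝ}
    (ha : ∀ uv, uv.2 ≠ 0 → a uv = 0) (i : ℕ) {j : ℕ} (hj : j ≠ 0) (x y : ℝ) :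
    derivAt S a i j x y = 0 := by
  refine Finset.sum_eq_zero fun uv _ => ?_
  by_cases hv : uv.2 = 0
  · simp [hv, Nat.descFactorial_eq_zero_iff_lt.2 (Nat.pos_of_ne_zero hj)]
  · simp [ha uv hv]

theorem derivAt_eq_zero_of_support_fst {S : Finset (ℕ × ℕ)} {a : ℕ × ℕ → ℝ}
    (ha : ∀ uv, uv.1 ≠ 0 → a uv = 0) {i : ℕ} (hi : i ≠ 0) (j : ℕ) (x y : ℝ) :
    derivAt S a i j x y = 0 := by
  refine Finset.sum_eq_zero fun uv _ => ?_
  by_cases hu : uv.1 = 0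
  · simp [hu, Nat.descFactorial_eq_zero_iff_lt.2 (Nat.pos_of_ne_zero hi)]
  · simp [ha uv hu]

theorem derivAt_congr_snd {S : Finset (ℕ × ℕ)} {a : ℕ × ℕ → ℝ}
    (ha : ∀ uv, uv.2 ≠ 0 → a uv = 0) (i j : ℕ) (x y y' : ℝ) :
    derivAt S a i j x y = derivAt S a i j x y' := by
  refine Finset.sum_congr rfl fun uv _ => ?_
  by_cases hv : uv.2 = 0
  · simp [hv]
  · simp [ha uv hv]

theorem derivAt_congr_fst {S : Finset (ℕ × ℕ)} {a : ℕ × ℕ → ℝ}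
    (ha : ∀ uv, uv.1 ≠ 0 → a uv = 0) (i j : ℕ) (x x' y : ℝ) :
    derivAt S a i j x y = derivAt S a i j x' y := by
  refine Finset.sum_congr rfl fun uv _ => ?_
  by_cases hu : uv.1 = 0
  · simp [hu]
  · simp [ha uv hu]

theorem card_setX (B : Finset (ℕ × ℕ)) : (setX B).card = (B.filter fun ij => ij.2 = 0).card := by
  refine Finset.card_image_of_injOn fun u hu v hv huv => ?_
  simp only [coe_filter, Set.mem_ofPred_eq] at hu hv
  exact Prod.ext huv (hu.2.trans hv.2.symm)

theorem card_setY (B : Finset (ℕ × ℕ)) : (setY B).card = (B.filter fun ij => ij.1 = 0).card := by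
  refine Finset.card_image_of_injOn fun u hu v hv huv => ?_
  simp only [coe_filter, Set.mem_ofPred_eq] at hu hv
  exact Prod.ext (hu.2.trans hv.2.symm) huv

theorem IsRect.card_eq {p q : ℕ} {Z : Finset (ℝ × ℝ)} (hZ : IsRect p q Z) :
    Z.card = (p + 1) * (q + 1) := by
  obtain ⟨x, y, hx, hy, rfl⟩ := hZ
  refine (Finset.card_image_of_injective _ (hx.prodMap hy)).trans ?_
  simp

theorem Regular.card_setX_le {p q : ℕ} {Z : Finset (ℝ × ℝ)} {A S : Finset (ℕ × ℕ)}
    (hreg : Regular Z A S) (hZ : IsRect p q Z) :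
    (setX S).card ≤ (setX A).card * (p + 1) := by
  obtain ⟨x, y, -, -, rfl⟩ := hZ
  have := hreg.card_le_of_forall_derivAt_eq_zero
    (Finset.filter_subset (fun ij : ℕ × ℕ => ij.2 = 0) S)
    (fun k : setX A × Fin (p + 1) => ((k.1 : ℕ), 0)) (fun k => (x k.2, 0)) ?_
  · simpa [card_setX S] using this
  · rintro a ha h z hz ⟨i, j⟩ hij
    have ha' : ∀ uv, uv.2 ≠ 0 → a uv = 0 := fun uv huv => ha uv (by simp [huv])
    obtain ⟨⟨k, l⟩, -, rfl⟩ := Finset.mem_image.1 hz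
    rcases eq_or_ne j 0 with rfl | hj
    · rw [derivAt_congr_snd ha' _ _ _ _ 0]
      exact h (⟨i, mem_setX.2 hij⟩, k)
    · exact derivAt_eq_zero_of_support_snd ha' _ hj _ _

theorem Regular.card_setY_le {p q : ℕ} {Z : Finset (ℝ × ℝ)} {A S : Finset (ℕ × ℕ)}
    (hreg : Regular Z A S) (hZ : IsRect p q Z) :
    (setY S).card ≤ (setY A).card * (q + 1) := by
  obtain ⟨x, y, -, -, rfl⟩ := hZ
  have := hreg.card_le_of_forall_derivAt_eq_zero
    (Finset.filter_subset (fun ij : ℕ × ℕ => ij.1 = 0) S)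
    (fun k : setY A × Fin (q + 1) => (0, (k.1 : ℕ))) (fun k => (0, y k.2)) ?_
  · simpa [card_setY S] using this
  · rintro a ha h z hz ⟨i, j⟩ hij
    have ha' : ∀ uv, uv.1 ≠ 0 → a uv = 0 := fun uv huv => ha uv (by simp [huv])
    obtain ⟨⟨k, l⟩, -, rfl⟩ := Finset.mem_image.1 hz
    rcases eq_or_ne i 0 with rfl | hi
    · rw [derivAt_congr_fst ha' _ _ _ 0]
      exact h (⟨j, mem_setY.2 hij⟩, l)
    · exact derivAt_eq_zero_of_support_fst ha' hi _ _ _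

theorem IsLower.subset_product {S : Finset (ℕ × ℕ)} (hS : IsLower S) :
    S ⊆ setX S ×ˢ setY S := fun ⟨u, v⟩ h =>
  Finset.mem_product.2 ⟨mem_setX.2 (hS u v h u 0 le_rfl v.zero_le),
    mem_setY.2 (hS u v h 0 v u.zero_le le_rfl)⟩

/-- for a normal regular scheme with `(p,q)`-rectangular nodes,
`|A| ≤ |A_x|·|A_y|`. -/
theorem card_le_mul (p q : ℕ) (Z : Finset (ℝ × ℝ)) (A S : Finset (ℕ × ℕ))
    (hZ : IsRect p q Z) (hS : IsLower S) (hnorm : S.card = Z.card * A.card)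
    (hreg : Regular Z A S) :
    A.card ≤ (setX A).card * (setY A).card := by
  refine Nat.le_of_mul_le_mul_left (c := (p + 1) * (q + 1)) ?_ (by positivity)
  calc (p + 1) * (q + 1) * A.card = S.card := by rw [hnorm, hZ.card_eq]
    _ ≤ (setX S).card * (setY S).card := by
        simpa using Finset.card_le_card hS.subset_product
    _ ≤ ((setX A).card * (p + 1)) * ((setY A).card * (q + 1)) :=
        Nat.mul_le_mul (hreg.card_setX_le hZ) (hreg.card_setY_le hZ)
    _ = (p + 1) * (q + 1) * ((setX A).card * (setY A).card) := by ring
end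

section
/- Let (Z,A,S) be a normal regular bivariate Birkhoff interpolation scheme in which Z is (p,q)-rectangular, and suppose |A| = |A_x|·|A_y|. Then S is the rectangle S = R(p',q') with p' = (p+1)|A_x| − 1 and q' = (q+1)|A_y| − 1. -/
open Finset

theorem card_filter_snd_eq_zero (A : Finset (ℕ × ℕ)) :
    (A.filter fun ij => ij.2 = 0).card = (setX A).card := by
  refine (card_image_of_injOn ?_).symm
  rintro ⟨a, b⟩ h ⟨c, d⟩ h' e
  simp_all

theorem card_filter_fst_eq_zero (A : Finset (ℕ × ℕ)) :
    (A.filter fun ij => ij.1 = 0).card = (setY A).card := by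
  refine (card_image_of_injOn ?_).symm
  rintro ⟨a, b⟩ h ⟨c, d⟩ h' e
  simp_all

/-- If, for polynomials supported on `T ⊆ S`, the homogeneous conditions indexed by `W` imply all
those of a regular scheme `(Z,A,S)`, then `W` has at least as many elements as `T`. -/
theorem Regular.card_le {Z : Finset (ℝ × ℝ)} {A S T : Finset (ℕ × ℕ)} (hreg : Regular Z A S)
    (hT : T ⊆ S) (W : Finset ((ℝ × ℝ) × (ℕ × ℕ)))
    (hW : ∀ a : ℕ × ℕ → ℝ, (∀ uv, uv ∉ T → a uv = 0) →
      (∀ w ∈ W, derivAt S a w.2.1 w.2.2 w.1.1 w.1.2 = 0) →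
      ∀ z ∈ Z, ∀ ij ∈ A, derivAt S a ij.1 ij.2 z.1 z.2 = 0) :
    T.card ≤ W.card := by
  by_contra! hlt
  let M : Matrix W T ℝ := fun w uv =>
    (uv.1.1.descFactorial w.1.2.1 : ℝ) * (uv.1.2.descFactorial w.1.2.2 : ℝ) *
      w.1.1.1 ^ (uv.1.1 - w.1.2.1) * w.1.1.2 ^ (uv.1.2 - w.1.2.2)
  have hker : LinearMap.ker M.mulVecLin ≠ ⊥ :=
    LinearMap.ker_ne_bot_of_finrank_lt (by simpa using hlt)
  obtain ⟨b, hb, hb0⟩ := Submodule.exists_mem_ne_zero_of_ne_bot hker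
  let a : ℕ × ℕ → ℝ := fun uv => if h : uv ∈ T then b ⟨uv, h⟩ else 0
  have haT : ∀ uv, uv ∉ T → a uv = 0 := fun uv h => dif_neg h
  have hcond : ∀ w ∈ W, derivAt S a w.2.1 w.2.2 w.1.1 w.1.2 = 0 := by
    intro w hw
    have hbw : ∑ uv : T, M ⟨w, hw⟩ uv * b uv = 0 := congrFun (LinearMap.mem_ker.mp hb) ⟨w, hw⟩
    rw [derivAt, ← sum_subset hT fun uv _ h => by simp [haT uv h], ← sum_coe_sort, ← hbw]
    refine sum_congr rfl fun uv _ => ?_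
    simp only [a, M, uv.2, dite_true]
    ring
  have ha0 : a = 0 := (hreg fun _ _ => 0).unique
    ⟨fun uv h => haT uv fun h' => h (hT h'), hW a haT hcond⟩ ⟨fun _ _ => rfl, by simp [derivAt]⟩
  refine hb0 (funext fun uv => ?_)
  simpa [a] using congrFun ha0 uv.1

theorem derivAt_of_supported_snd_eq_zero {S : Finset (ℕ × ℕ)} {a : ℕ × ℕ → ℝ}
    (ha : ∀ uv : ℕ × ℕ, uv.2 ≠ 0 → a uv = 0) (i j : ℕ) (x y y' : ℝ) :
    derivAt S a i j x y = if j = 0 then derivAt S a i 0 x y' else 0 := by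
  split_ifs with hj
  · subst hj
    refine sum_congr rfl fun uv _ => ?_
    by_cases h : uv.2 = 0 <;> simp [h, ha]
  · refine sum_eq_zero fun uv _ => ?_
    by_cases h : uv.2 = 0
    · simp [h, Nat.descFactorial_of_lt (Nat.pos_of_ne_zero hj)]
    · simp [ha uv h]

theorem derivAt_of_supported_fst_eq_zero {S : Finset (ℕ × ℕ)} {a : ℕ × ℕ → ℝ}
    (ha : ∀ uv : ℕ × ℕ, uv.1 ≠ 0 → a uv = 0) (i j : ℕ) (x x' y : ℝ) :
    derivAt S a i j x y = if i = 0 then derivAt S a 0 j x' y else 0 := by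
  split_ifs with hi
  · subst hi
    refine sum_congr rfl fun uv _ => ?_
    by_cases h : uv.1 = 0 <;> simp [h, ha]
  · refine sum_eq_zero fun uv _ => ?_
    by_cases h : uv.1 = 0
    · simp [h, Nat.descFactorial_of_lt (Nat.pos_of_ne_zero hi)]
    · simp [ha uv h]

theorem Regular.fst_lt {p q : ℕ} {Z : Finset (ℝ × ℝ)} {A S : Finset (ℕ × ℕ)}
    (hreg : Regular Z A S) (hZ : IsRect p q Z) (hS : IsLower S) {u v : ℕ} (huv : (u, v) ∈ S) :
    u < (p + 1) * (setX A).card := by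
  obtain ⟨x, y, hx, -, rfl⟩ := hZ
  have hT : range (u + 1) ×ˢ {0} ⊆ S := by
    rintro ⟨i, j⟩ h
    obtain ⟨hi, hj⟩ := mem_product.mp h
    exact hS u v huv i j (Nat.lt_succ_iff.mp (mem_range.mp hi))
      ((mem_singleton.mp hj).trans_le v.zero_le)
  have hle := hreg.card_le hT
    (univ.image (fun k => (x k, y 0)) ×ˢ A.filter fun ij => ij.2 = 0) ?_
  · rw [card_product, card_product, card_filter_snd_eq_zero, card_image_of_injective _
      fun k l h => hx (congrArg Prod.fst h)] at hle
    simpa using hle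
  · intro a ha hw z hz ij hij
    obtain ⟨⟨k, l⟩, -, rfl⟩ := mem_image.mp hz
    rw [derivAt_of_supported_snd_eq_zero (fun uv h => ha uv fun h' =>
      h (mem_singleton.mp (mem_product.mp h').2)) _ _ _ _ (y 0)]
    split_ifs with hj
    · simpa [hj] using hw ((x k, y 0), ij) (by simp [hij, hj])
    · rfl

theorem Regular.snd_lt {p q : ℕ} {Z : Finset (ℝ × ℝ)} {A S : Finset (ℕ × ℕ)}
    (hreg : Regular Z A S) (hZ : IsRect p q Z) (hS : IsLower S) {u v : ℕ} (huv : (u, v) ∈ S) :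
    v < (q + 1) * (setY A).card := by
  obtain ⟨x, y, -, hy, rfl⟩ := hZ
  have hT : {0} ×ˢ range (v + 1) ⊆ S := by
    rintro ⟨i, j⟩ h
    obtain ⟨hi, hj⟩ := mem_product.mp h
    exact hS u v huv i j ((mem_singleton.mp hi).trans_le u.zero_le)
      (Nat.lt_succ_iff.mp (mem_range.mp hj))
  have hle := hreg.card_le hT
    (univ.image (fun k => (x 0, y k)) ×ˢ A.filter fun ij => ij.1 = 0) ?_
  · rw [card_product, card_product, card_filter_fst_eq_zero, card_image_of_injective _
      fun k l h => hy (congrArg Prod.snd h)] at hle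
    simpa using hle
  · intro a ha hw z hz ij hij
    obtain ⟨⟨k, l⟩, -, rfl⟩ := mem_image.mp hz
    rw [derivAt_of_supported_fst_eq_zero (fun uv h => ha uv fun h' =>
      h (mem_singleton.mp (mem_product.mp h').1)) _ _ _ (x 0)]
    split_ifs with hi
    · simpa [hi] using hw ((x 0, y l), ij) (by simp [hij, hi])
    · rfl

/-- in the limit case `|A| = |A_x|·|A_y|`, `S` must be the
rectangle `R(p',q')` with `p' = (p+1)|A_x| - 1`, `q' = (q+1)|A_y| - 1`. -/
theorem limit_case_rectangle (p q p' q' : ℕ) (Z : Finset (ℝ × ℝ)) (A S : Finset (ℕ × ℕ))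
    (hZ : IsRect p q Z) (hS : IsLower S) (hnorm : S.card = Z.card * A.card)
    (hreg : Regular Z A S)
    (heq : A.card = (setX A).card * (setY A).card)
    (hp' : p' + 1 = (p + 1) * (setX A).card)
    (hq' : q' + 1 = (q + 1) * (setY A).card) :
    S = rect p' q' := by
  refine eq_of_subset_of_card_le ?_ ?_
  · rintro ⟨u, v⟩ huv
    simp only [rect, mem_product, mem_range, hp', hq']
    exact ⟨hreg.fst_lt hZ hS huv, hreg.snd_lt hZ hS huv⟩
  · rw [rect, card_product, card_range, card_range, hp', hq', hnorm, hZ.card_eq, heq]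
    exact le_of_eq (by ring)
end

section
/- Let (Z,A,S) be a normal bivariate Birkhoff interpolation scheme in which Z is (p,q)-rectangular. If (Z,A,S) is solvable and A contains a lower set R, then S contains the blow-up R^{p,q}. -/
open Finset

open Polynomial in
/-- A real polynomial whose derivatives of order `≤ i` vanish at every node is zero as soon as its
degree is smaller than the number of these Hermite conditions. -/
theorem eq_zero_of_iterate_derivative_eval_eq_zero {ι : Type*} [Fintype ι] {x : ι → ℝ}
    (hx : Function.Injective x) {i : ℕ} {P : ℝ[X]}
    (hdeg : P.degree < (Fintype.card ι * (i + 1) : ℕ))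
    (hP : ∀ s, ∀ a ≤ i, (derivative^[a] P).eval (x s) = 0) : P = 0 := by
  by_contra h0
  have hdvd : ∏ s, (X - C (x s)) ^ (i + 1) ∣ P := by
    refine Finset.prod_dvd_of_coprime (fun s _ t _ hst => ?_) (fun s _ => ?_)
    · exact (pairwise_coprime_X_sub_C hx hst).pow
    · rw [← le_rootMultiplicity_iff h0]
      exact (lt_rootMultiplicity_iff_isRoot_iterate_derivative h0).2 fun a ha => hP s a ha
  refine absurd (degree_le_of_dvd hdvd h0) (not_le.2 ?_)
  simpa [degree_prod, degree_pow, mul_add] using hdeg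

open Polynomial in
/-- The Hermite divided difference: a combination of derivatives of order `≤ i` at the nodes that
extracts the top coefficient of polynomials of degree less than the number of conditions. -/
theorem exists_hermite_weights {ι : Type*} [Fintype ι] {x : ι → ℝ}
    (hx : Function.Injective x) (i n : ℕ) (hn : n < Fintype.card ι * (i + 1)) :
    ∃ w : ι × Fin (i + 1) → ℝ, ∀ k ≤ n,
      ∑ t, w t * ((k.descFactorial t.2 : ℝ) * x t.1 ^ (k - t.2)) = if k = n then 1 else 0 := by
  classical
  let E : ℝ[X] →ₗ[ℝ] (ι × Fin (i + 1) → ℝ) :=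
    LinearMap.pi fun t => leval (x t.1) ∘ₗ derivative ^ (t.2 : ℕ)
  have hE : ∀ P t, E P t = (derivative^[(t.2 : ℕ)] P).eval (x t.1) := fun P t => by
    simp [E, Module.End.pow_apply]
  obtain ⟨g, hg⟩ := (E ∘ₗ (degreeLT ℝ (n + 1)).subtype).exists_leftInverse_of_injective <| by
    rw [LinearMap.ker_eq_bot']
    rintro ⟨P, hPd⟩ hP
    rw [mem_degreeLT] at hPd
    ext1
    refine eq_zero_of_iterate_derivative_eval_eq_zero (i := i) hx
      (hPd.trans_le (by exact_mod_cast hn)) fun s a ha => ?_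
    rw [← hE P (s, ⟨a, Nat.lt_succ_of_le ha⟩)]
    exact congrFun hP _
  let φ : (ι × Fin (i + 1) → ℝ) →ₗ[ℝ] ℝ := lcoeff ℝ n ∘ₗ (degreeLT ℝ (n + 1)).subtype ∘ₗ g
  refine ⟨fun t => φ (Pi.single t 1), fun k hk => ?_⟩
  have hmem : (X ^ k : ℝ[X]) ∈ degreeLT ℝ (n + 1) := by
    rw [mem_degreeLT, degree_X_pow]
    exact_mod_cast Nat.lt_succ_of_le hk
  have hφ : φ (E (X ^ k)) = if k = n then 1 else 0 := by
    have := LinearMap.congr_fun hg ⟨X ^ k, hmem⟩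
    simp only [LinearMap.comp_apply, Submodule.subtype_apply, LinearMap.id_apply] at this
    simp [φ, this, coeff_X_pow, eq_comm]
  rw [← hφ, LinearMap.pi_apply_eq_sum_univ φ]
  refine Finset.sum_congr rfl fun t _ => ?_
  rw [hE, iterate_derivative_X_pow_eq_natCast_mul, smul_eq_mul, mul_comm]
  congr 1
  · simp
  · exact congrArg φ (funext fun s => by simp [Pi.single_apply, eq_comm])

/-- Solvability with the full rectangle of derivative orders forces the top corner of the
blown-up rectangle into `S`. -/
theorem corner_mem_of_solvable {p q : ℕ} {Z : Finset (ℝ × ℝ)} {A S : Finset (ℕ × ℕ)}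
    (hZ : IsRect p q Z) (hS : IsLower S) (hsolv : Solvable Z A S) {i j : ℕ}
    (hA : ∀ a ≤ i, ∀ b ≤ j, (a, b) ∈ A) :
    ((p + 1) * i + p, (q + 1) * j + q) ∈ S := by
  by_contra hnot
  obtain ⟨x, y, hx, hy, rfl⟩ := hZ
  set u := (p + 1) * i + p with hu
  set v := (q + 1) * j + q with hv
  obtain ⟨w, hw⟩ := exists_hermite_weights hx i u (by rw [Fintype.card_fin, mul_add]; omega)
  obtain ⟨w', hw'⟩ := exists_hermite_weights hy j v (by rw [Fintype.card_fin, mul_add]; omega)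
  obtain ⟨a, -, ha⟩ := hsolv fun d z =>
    ((u.descFactorial d.1 : ℝ) * z.1 ^ (u - d.1)) * ((v.descFactorial d.2 : ℝ) * z.2 ^ (v - d.2))
  have hone : ∑ t, ∑ t', w t * w' t' * derivAt S a t.2 t'.2 (x t.1) (y t'.1) = 1 := by
    calc _ = (∑ t, w t * ((u.descFactorial t.2 : ℝ) * x t.1 ^ (u - t.2))) *
          ∑ t', w' t' * ((v.descFactorial t'.2 : ℝ) * y t'.1 ^ (v - t'.2)) := by
          rw [Finset.sum_mul_sum]
          refine Finset.sum_congr rfl fun t _ => Finset.sum_congr rfl fun t' _ => ?_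
          rw [ha (x t.1, y t'.1) (Finset.mem_image.2 ⟨(t.1, t'.1), Finset.mem_univ _, rfl⟩)
            (t.2, t'.2) (hA _ (Nat.le_of_lt_succ t.2.2) _ (Nat.le_of_lt_succ t'.2.2))]
          ring
      _ = 1 := by rw [hw u le_rfl, hw' v le_rfl]; simp
  have hzero : ∑ t, ∑ t', w t * w' t' * derivAt S a t.2 t'.2 (x t.1) (y t'.1) = 0 := by
    calc _ = ∑ m ∈ S, a m * ((∑ t, w t * ((m.1.descFactorial t.2 : ℝ) * x t.1 ^ (m.1 - t.2))) *
          ∑ t', w' t' * ((m.2.descFactorial t'.2 : ℝ) * y t'.1 ^ (m.2 - t'.2))) := by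
          simp only [derivAt, Finset.sum_mul_sum]
          simp only [Finset.mul_sum]
          rw [Finset.sum_comm (s := S)]
          refine Finset.sum_congr rfl fun t _ => ?_
          rw [Finset.sum_comm (s := S)]
          refine Finset.sum_congr rfl fun t' _ => Finset.sum_congr rfl fun m _ => ?_
          ring
      _ = 0 := by
          refine Finset.sum_eq_zero fun m hm => ?_
          have hlt : m.1 < u ∨ m.2 < v := by
            by_contra! h
            exact hnot (hS m.1 m.2 hm u v h.1 h.2)
          rcases hlt with h | h
          · rw [hw m.1 h.le, if_neg h.ne, zero_mul, mul_zero]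
          · rw [hw' m.2 h.le, if_neg h.ne, mul_zero, mul_zero]
  exact one_ne_zero (hone.symm.trans hzero)

/-- if `(Z,A,S)` is solvable with `(p,q)`-rectangular nodes and
`A` contains a lower set `R`, then `S` contains the blow-up `R^{p,q}`. -/
theorem solvable_contains_blowup (p q : ℕ) (Z : Finset (ℝ × ℝ)) (A S R : Finset (ℕ × ℕ))
    (hZ : IsRect p q Z) (hS : IsLower S) (hnorm : S.card = Z.card * A.card)
    (hsolv : Solvable Z A S) (hR : IsLower R) (hRA : R ⊆ A) :
    blowup p q R ⊆ S := by
  intro z hz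
  simp only [blowup, Finset.mem_image, Finset.mem_product, Finset.mem_range] at hz
  obtain ⟨⟨⟨i, j⟩, c, d⟩, ⟨hij, hc, hd⟩, rfl⟩ := hz
  exact hS _ _ (corner_mem_of_solvable hZ hS hsolv fun a ha b hb => hRA (hR i j hij a b ha hb)) _ _
    (Nat.add_le_add_left (Nat.le_of_lt_succ hc) _)
    (Nat.add_le_add_left (Nat.le_of_lt_succ hd) _)
end

section
/- Let (Z,A,S) be a normal bivariate Birkhoff interpolation scheme in which Z is (p,q)-rectangular and the set A of derivative orders is itself a lower set. Then (Z,A,S) is regular if and only if S = A^{p,q}. -/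
open Finset

open Polynomial in
theorem eval_iterate_derivative_eq_sum_range (f : ℝ[X]) (i : ℕ) (x : ℝ) :
    (derivative^[i] f).eval x =
      ∑ u ∈ range (f.natDegree + 1), f.coeff u * (u.descFactorial i : ℝ) * x ^ (u - i) := by
  conv_lhs => rw [f.as_sum_range_C_mul_X_pow]
  rw [iterate_derivative_sum, eval_finsetSum]
  refine sum_congr rfl fun u _ => ?_
  rw [iterate_derivative_C_mul, iterate_derivative_X_pow_eq_natCast_mul]
  simp [mul_assoc]

open Polynomial in
theorem derivAt_coeff_mul_coeff {S : Finset (ℕ × ℕ)} {f g : ℝ[X]}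
    (h : ∀ u v, u ≤ f.natDegree → v ≤ g.natDegree → (u, v) ∈ S) (i j : ℕ) (x y : ℝ) :
    derivAt S (fun uv => f.coeff uv.1 * g.coeff uv.2) i j x y =
      (derivative^[i] f).eval x * (derivative^[j] g).eval y := by
  rw [eval_iterate_derivative_eq_sum_range, eval_iterate_derivative_eq_sum_range,
    sum_mul_sum, ← sum_product']
  symm
  refine (sum_congr rfl fun uv _ => ?_).trans (sum_subset (f := fun uv : ℕ × ℕ =>
    f.coeff uv.1 * g.coeff uv.2 * (uv.1.descFactorial i : ℝ) * (uv.2.descFactorial j : ℝ) *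
      x ^ (uv.1 - i) * y ^ (uv.2 - j)) ?_ ?_)
  · ring
  · rintro ⟨u, v⟩ huv
    simp only [mem_product, mem_range] at huv
    exact h u v (by lia) (by lia)
  · rintro ⟨u, v⟩ _ huv
    simp only [mem_product, mem_range, not_and_or, not_lt] at huv
    rcases huv with hu | hv
    · simp [coeff_eq_zero_of_natDegree_lt (show f.natDegree < u by lia)]
    · simp [coeff_eq_zero_of_natDegree_lt (show g.natDegree < v by lia)]

open Polynomial in
theorem eval_iterate_derivative_eq_zero_of_pow_dvd {f : ℝ[X]} {t : ℝ} {i n : ℕ} (hi : i < n)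
    (h : (X - C t) ^ n ∣ f) : (derivative^[i] f).eval t = 0 := by
  have h' := (dvd_pow_self (X - C t) (by lia)).trans (pow_sub_dvd_iterate_derivative_of_pow_dvd i h)
  exact dvd_iff_isRoot.mp h'

open Polynomial in
theorem eval_iterate_derivative_mul_X_sub_C_pow_ne_zero {g : ℝ[X]} {t : ℝ} (i : ℕ)
    (hg : g.eval t ≠ 0) : (derivative^[i] (g * (X - C t) ^ i)).eval t ≠ 0 := by
  have hg0 : g ≠ 0 := by rintro rfl; simp at hg
  have hm : (g * (X - C t) ^ i).rootMultiplicity t = i := by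
    rw [rootMultiplicity_mul_X_sub_C_pow hg0, rootMultiplicity_eq_zero hg, zero_add]
  have h := eval_iterate_derivative_rootMultiplicity (p := g * (X - C t) ^ i) (t := t)
  have h0 := eval_divByMonic_pow_rootMultiplicity_ne_zero (p := g * (X - C t) ^ i) t
    (mul_ne_zero hg0 (pow_ne_zero _ (X_sub_C_ne_zero t)))
  rw [hm] at h h0
  rw [h, nsmul_eq_mul]
  exact mul_ne_zero (by exact_mod_cast i.factorial_ne_zero) h0

/-- The polynomial `∏ₗ (X - xₗ)ⁱ · ∏_{l ≠ k} (X - xₗ)`, whose derivatives up to order `i` at the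
nodes all vanish, except for the `i`-th one at `xₖ`. -/
noncomputable def hermiteNodal {p : ℕ} (x : Fin (p + 1) → ℝ) (i : ℕ) (k : Fin (p + 1)) :
    Polynomial ℝ :=
  Lagrange.nodal univ x ^ i * Lagrange.nodal (univ.erase k) x

theorem natDegree_hermiteNodal {p : ℕ} (x : Fin (p + 1) → ℝ) (i : ℕ) (k : Fin (p + 1)) :
    (hermiteNodal x i k).natDegree = (p + 1) * i + p := by
  rw [hermiteNodal, (Lagrange.nodal_monic.pow i).natDegree_mul Lagrange.nodal_monic,
    Lagrange.nodal_monic.natDegree_pow, Lagrange.natDegree_nodal, Lagrange.natDegree_nodal,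
    card_erase_of_mem (mem_univ k)]
  simp [mul_comm]

open Polynomial in
theorem eval_iterate_derivative_hermiteNodal_of_lt {p : ℕ} (x : Fin (p + 1) → ℝ) {i i' : ℕ}
    (h : i < i') (k k' : Fin (p + 1)) :
    (derivative^[i] (hermiteNodal x i' k')).eval (x k) = 0 :=
  eval_iterate_derivative_eq_zero_of_pow_dvd h
    ((pow_dvd_pow_of_dvd (Lagrange.X_sub_C_dvd_nodal x (mem_univ k)) i').mul_right _)

open Polynomial in
theorem eval_iterate_derivative_hermiteNodal_of_ne {p : ℕ} (x : Fin (p + 1) → ℝ) (i : ℕ)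
    {k k' : Fin (p + 1)} (h : k ≠ k') :
    (derivative^[i] (hermiteNodal x i k')).eval (x k) = 0 :=
  eval_iterate_derivative_eq_zero_of_pow_dvd i.lt_succ_self <| by
    rw [pow_succ]
    exact mul_dvd_mul (pow_dvd_pow_of_dvd (Lagrange.X_sub_C_dvd_nodal x (mem_univ k)) i)
      (Lagrange.X_sub_C_dvd_nodal x (mem_erase.mpr ⟨h, mem_univ k⟩))

open Polynomial in
theorem eval_iterate_derivative_hermiteNodal_self_ne_zero {p : ℕ} {x : Fin (p + 1) → ℝ}
    (hx : Function.Injective x) (i : ℕ) (k : Fin (p + 1)) :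
    (derivative^[i] (hermiteNodal x i k)).eval (x k) ≠ 0 := by
  have hg : (Lagrange.nodal (univ.erase k) x).eval (x k) ≠ 0 :=
    Lagrange.eval_nodal_not_at_node fun l hl => hx.ne (ne_of_mem_erase hl).symm
  have : hermiteNodal x i k =
      Lagrange.nodal (univ.erase k) x ^ (i + 1) * (X - C (x k)) ^ i := by
    rw [hermiteNodal, Lagrange.nodal_eq_mul_nodal_erase (mem_univ k), mul_pow]
    ring
  rw [this]
  exact eval_iterate_derivative_mul_X_sub_C_pow_ne_zero i (by rw [eval_pow]; exact pow_ne_zero _ hg)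

theorem mem_blowup {p q : ℕ} {A : Finset (ℕ × ℕ)} {u v : ℕ} :
    (u, v) ∈ blowup p q A ↔ (u / (p + 1), v / (q + 1)) ∈ A := by
  simp only [blowup, mem_image, mem_product, mem_range, Prod.exists, Prod.mk.injEq]
  constructor
  · rintro ⟨i, j, r, s, ⟨hA, hr, hs⟩, rfl, rfl⟩
    rwa [Nat.mul_add_div (by lia), Nat.mul_add_div (by lia), Nat.div_eq_of_lt hr,
      Nat.div_eq_of_lt hs]
  · intro h
    exact ⟨_, _, u % (p + 1), v % (q + 1), ⟨h, Nat.mod_lt _ (by lia), Nat.mod_lt _ (by lia)⟩,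
      Nat.div_add_mod _ _, Nat.div_add_mod _ _⟩

theorem card_blowup (p q : ℕ) (A : Finset (ℕ × ℕ)) :
    (blowup p q A).card = (p + 1) * (q + 1) * A.card := by
  rw [blowup, card_image_of_injOn, card_product, card_product, card_range, card_range, mul_comm]
  rintro ⟨⟨i, j⟩, r, s⟩ h ⟨⟨i', j'⟩, r', s'⟩ h' heq
  simp only [coe_product, Set.mem_prod, mem_coe, mem_range, Prod.mk.injEq] at h h' heq ⊢
  have key : ∀ {m a b c d : ℕ}, b < m → d < m → m * a + b = m * c + d → a = c ∧ b = d := by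
    intro m a b c d hb hd h
    have hac : a = c := by
      have := congrArg (· / m) h
      simpa [Nat.mul_add_div (show 0 < m by lia), Nat.div_eq_of_lt hb, Nat.div_eq_of_lt hd]
        using this
    subst hac
    exact ⟨rfl, by lia⟩
  obtain ⟨h1, h2⟩ := key h.2.1 h'.2.1 heq.1
  obtain ⟨h3, h4⟩ := key h.2.2 h'.2.2 heq.2
  exact ⟨⟨h1, h3⟩, h2, h4⟩

theorem subset_blowup_of_regular {p q : ℕ} {x : Fin (p + 1) → ℝ} {y : Fin (q + 1) → ℝ}
    {Z : Finset (ℝ × ℝ)} {A S : Finset (ℕ × ℕ)}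
    (hZ : Z = (univ : Finset (Fin (p + 1) × Fin (q + 1))).image fun ij => (x ij.1, y ij.2))
    (hS : IsLower S) (hA : IsLower A) (hreg : Regular Z A S) : S ⊆ blowup p q A := by
  rintro ⟨u, v⟩ huv
  rw [mem_blowup]
  by_contra hnot
  set i₀ := u / (p + 1)
  set j₀ := v / (q + 1)
  have hu : (p + 1) * i₀ ≤ u := Nat.mul_div_le _ _
  have hv : (q + 1) * j₀ ≤ v := Nat.mul_div_le _ _
  set f := Lagrange.nodal univ x ^ i₀
  set g := Lagrange.nodal univ y ^ j₀
  have hfm : f.Monic := Lagrange.nodal_monic.pow _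
  have hgm : g.Monic := Lagrange.nodal_monic.pow _
  have hf : f.natDegree = (p + 1) * i₀ := by
    simp [f, Lagrange.nodal_monic.natDegree_pow, Lagrange.natDegree_nodal, mul_comm]
  have hg : g.natDegree = (q + 1) * j₀ := by
    simp [g, Lagrange.nodal_monic.natDegree_pow, Lagrange.natDegree_nodal, mul_comm]
  have hsub : ∀ a b, a ≤ f.natDegree → b ≤ g.natDegree → (a, b) ∈ S :=
    fun a b ha hb => hS u v huv a b (by lia) (by lia)
  have heq := (hreg 0).unique (y₁ := fun uv => f.coeff uv.1 * g.coeff uv.2) (y₂ := 0)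
    ⟨fun ⟨a, b⟩ hab => ?_, fun z hz ⟨i, j⟩ hij => ?_⟩ ⟨fun _ _ => rfl, by simp [derivAt]⟩
  · have := congrFun heq (f.natDegree, g.natDegree)
    simp [hfm.leadingCoeff, hgm.leadingCoeff] at this
  · by_contra hne
    obtain ⟨h1, h2⟩ := mul_ne_zero_iff.mp hne
    exact hab (hsub a b (Polynomial.le_natDegree_of_ne_zero h1)
      (Polynomial.le_natDegree_of_ne_zero h2))
  · subst hZ
    obtain ⟨⟨k, l⟩, -, rfl⟩ := mem_image.mp hz
    rw [derivAt_coeff_mul_coeff hsub]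
    by_cases hi : i < i₀
    · rw [eval_iterate_derivative_eq_zero_of_pow_dvd hi
        (pow_dvd_pow_of_dvd (Lagrange.X_sub_C_dvd_nodal x (mem_univ k)) i₀)]
      simp
    · by_cases hj : j < j₀
      · rw [eval_iterate_derivative_eq_zero_of_pow_dvd hj
          (pow_dvd_pow_of_dvd (Lagrange.X_sub_C_dvd_nodal y (mem_univ l)) j₀)]
        simp
      · exact absurd (hA i j hij i₀ j₀ (by lia) (by lia)) hnot

/-- The Birkhoff data at the nodes `(xₖ, yₗ)` of the polynomial with given coefficients,
as a linear map. -/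
noncomputable def birkhoffData {p q : ℕ} (x : Fin (p + 1) → ℝ) (y : Fin (q + 1) → ℝ)
    (A S : Finset (ℕ × ℕ)) :
    (ℕ × ℕ → ℝ) →ₗ[ℝ] (A × Fin (p + 1) × Fin (q + 1) → ℝ) where
  toFun a κ := derivAt S a κ.1.1.1 κ.1.1.2 (x κ.2.1) (y κ.2.2)
  map_add' a b := by
    ext κ
    simp only [derivAt, Pi.add_apply, ← sum_add_distrib]
    exact sum_congr rfl fun _ _ => by ring
  map_smul' r a := by
    ext κ
    simp only [derivAt, Pi.smul_apply, smul_eq_mul, mul_sum, RingHom.id_apply]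
    exact sum_congr rfl fun _ _ => by ring

/-- The coefficients of `hermiteNodal x i k (X) * hermiteNodal y j l (Y)`. -/
noncomputable def hermiteCoeff {p q : ℕ} (x : Fin (p + 1) → ℝ) (y : Fin (q + 1) → ℝ)
    {A : Finset (ℕ × ℕ)} (κ : A × Fin (p + 1) × Fin (q + 1)) : ℕ × ℕ → ℝ :=
  fun uv => (hermiteNodal x κ.1.1.1 κ.2.1).coeff uv.1 * (hermiteNodal y κ.1.1.2 κ.2.2).coeff uv.2

theorem linearIndependent_birkhoffData_hermiteCoeff {p q : ℕ} {x : Fin (p + 1) → ℝ}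
    {y : Fin (q + 1) → ℝ} (hx : Function.Injective x) (hy : Function.Injective y)
    {A : Finset (ℕ × ℕ)} (hA : IsLower A) :
    LinearIndependent ℝ fun κ : A × Fin (p + 1) × Fin (q + 1) =>
      birkhoffData x y A (blowup p q A) (hermiteCoeff x y κ) := by
  have hval : ∀ κ κ' : A × Fin (p + 1) × Fin (q + 1),
      birkhoffData x y A (blowup p q A) (hermiteCoeff x y κ') κ =
        (Polynomial.derivative^[κ.1.1.1] (hermiteNodal x κ'.1.1.1 κ'.2.1)).eval (x κ.2.1) *
        (Polynomial.derivative^[κ.1.1.2] (hermiteNodal y κ'.1.1.2 κ'.2.2)).eval (y κ.2.2) := by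
    intro κ κ'
    refine derivAt_coeff_mul_coeff (fun u v hu hv => ?_) _ _ _ _
    rw [natDegree_hermiteNodal] at hu hv
    refine mem_blowup.mpr (hA _ _ κ'.1.2 _ _ ?_ ?_)
    · rw [← Nat.lt_succ_iff, Nat.div_lt_iff_lt_mul (by lia), Nat.succ_eq_add_one, add_mul]
      lia
    · rw [← Nat.lt_succ_iff, Nat.div_lt_iff_lt_mul (by lia), Nat.succ_eq_add_one, add_mul]
      lia
  rw [Fintype.linearIndependent_iff]
  intro c hc κ
  induction hn : κ.1.1.1 + κ.1.1.2 using Nat.strong_induction_on generalizing κ with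
  | _ n ih =>
  have hκ := congrFun hc κ
  rw [Finset.sum_apply, sum_eq_single κ] at hκ
  · rw [Pi.smul_apply, smul_eq_mul, hval] at hκ
    exact (mul_eq_zero.mp hκ).resolve_right (mul_ne_zero
      (eval_iterate_derivative_hermiteNodal_self_ne_zero hx _ _)
      (eval_iterate_derivative_hermiteNodal_self_ne_zero hy _ _))
  · intro κ' _ hne
    rw [Pi.smul_apply, smul_eq_mul, hval]
    obtain ⟨⟨⟨i, j⟩, hij⟩, k, l⟩ := κ
    obtain ⟨⟨⟨i', j'⟩, hij'⟩, k', l'⟩ := κ'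
    dsimp only at hn ⊢
    rcases lt_or_ge i i' with hi | hi
    · rw [eval_iterate_derivative_hermiteNodal_of_lt x hi]
      simp
    rcases lt_or_ge j j' with hj | hj
    · rw [eval_iterate_derivative_hermiteNodal_of_lt y hj]
      simp
    by_cases hlt : i' + j' < n
    · rw [ih _ hlt _ rfl, zero_mul]
    obtain rfl : i' = i := by lia
    obtain rfl : j' = j := by lia
    by_cases hk : k = k'
    · have hl : l ≠ l' := by
        rintro rfl
        exact hne (by rw [hk])
      rw [eval_iterate_derivative_hermiteNodal_of_ne y _ hl]
      simp
    · rw [eval_iterate_derivative_hermiteNodal_of_ne x _ hk]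
      simp
  · simp

theorem birkhoffData_congr {p q : ℕ} (x : Fin (p + 1) → ℝ) (y : Fin (q + 1) → ℝ)
    (A : Finset (ℕ × ℕ)) {S : Finset (ℕ × ℕ)} {a b : ℕ × ℕ → ℝ} (h : ∀ uv ∈ S, a uv = b uv) :
    birkhoffData x y A S a = birkhoffData x y A S b := by
  ext κ
  exact sum_congr rfl fun uv huv => by rw [h uv huv]

theorem regular_blowup {p q : ℕ} {x : Fin (p + 1) → ℝ} {y : Fin (q + 1) → ℝ}
    (hx : Function.Injective x) (hy : Function.Injective y) {Z : Finset (ℝ × ℝ)}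
    {A : Finset (ℕ × ℕ)}
    (hZ : Z = (univ : Finset (Fin (p + 1) × Fin (q + 1))).image fun ij => (x ij.1, y ij.2))
    (hA : IsLower A) : Regular Z A (blowup p q A) := by
  set S := blowup p q A with hSdef
  let E : (S → ℝ) →ₗ[ℝ] (ℕ × ℕ → ℝ) := Function.ExtendByZero.linearMap ℝ Subtype.val
  have hE : ∀ (a : S → ℝ) (uv : S), E a uv = a uv := fun a uv =>
    Subtype.val_injective.extend_apply a 0 uv
  have hE0 : ∀ (a : S → ℝ) uv, uv ∉ S → E a uv = 0 := fun a uv huv =>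
    Function.extend_apply' (f := Subtype.val) a 0 uv (by rintro ⟨s, rfl⟩; exact huv s.2)
  have hT : ∀ a : ℕ × ℕ → ℝ,
      birkhoffData x y A S (E fun s => a s) = birkhoffData x y A S a := fun a =>
    birkhoffData_congr x y A fun uv huv => hE (fun s => a s) ⟨uv, huv⟩
  let T := birkhoffData x y A S ∘ₗ E
  have hsurj : Function.Surjective T := by
    have hspan := LinearIndependent.span_eq_top_of_card_eq_finrank'
      (linearIndependent_birkhoffData_hermiteCoeff hx hy hA) (by simp)
    rw [← LinearMap.range_eq_top, eq_top_iff, ← hspan, Submodule.span_le]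
    rintro _ ⟨κ, rfl⟩
    exact ⟨fun s => hermiteCoeff x y κ s, hT _⟩
  have hinj : Function.Injective T := by
    refine (LinearMap.injective_iff_surjective_of_finrank_eq_finrank ?_).mpr hsurj
    simp [hSdef, card_blowup, mul_comm]
  intro c
  have hiff : ∀ a : ℕ × ℕ → ℝ, (∀ z ∈ Z, ∀ ij ∈ A, derivAt S a ij.1 ij.2 z.1 z.2 = c ij z) ↔
      birkhoffData x y A S a = fun κ => c κ.1 (x κ.2.1, y κ.2.2) := by
    intro a
    subst hZ
    constructor
    · intro h
      ext κ
      exact h _ (mem_image_of_mem _ (mem_univ κ.2)) _ κ.1.2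
    · intro h z hz ij hij
      obtain ⟨kl, -, rfl⟩ := mem_image.mp hz
      exact congrFun h (⟨ij, hij⟩, kl)
  simp only [hiff]
  obtain ⟨a, ha⟩ := hsurj fun κ => c κ.1 (x κ.2.1, y κ.2.2)
  refine ⟨E a, ⟨hE0 a, ha⟩, fun b ⟨hb0, hb⟩ => ?_⟩
  have hba : (fun s : S => b s) = a := hinj (by rw [ha, ← hb]; exact hT b)
  ext uv
  by_cases huv : uv ∈ S
  · rw [← hba, hE _ ⟨uv, huv⟩]
  · rw [hb0 uv huv, hE0 a uv huv]

/-- if `A` is itself a lower set, then `(Z,A,S)` with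
`(p,q)`-rectangular nodes is regular iff `S = A^{p,q}`. -/
theorem regular_iff_blowup (p q : ℕ) (Z : Finset (ℝ × ℝ)) (A S : Finset (ℕ × ℕ))
    (hZ : IsRect p q Z) (hS : IsLower S) (hnorm : S.card = Z.card * A.card)
    (hA : IsLower A) :
    Regular Z A S ↔ S = blowup p q A := by
  obtain ⟨x, y, hx, hy, hZ⟩ := hZ
  constructor
  · intro hreg
    refine eq_of_subset_of_card_le (subset_blowup_of_regular hZ hS hA hreg) ?_
    have hinj : Function.Injective fun ij : Fin (p + 1) × Fin (q + 1) => (x ij.1, y ij.2) :=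
      hx.prodMap hy
    rw [card_blowup, hnorm, hZ, card_image_of_injective _ hinj]
    simp
  · rintro rfl
    exact regular_blowup hx hy hZ hA
end
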